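/- arXiv:1210.3311 — 2 statements merged into one kernel-verified Lean document; each statement's English description precedes it below -/
import Mathlib

section
/- Let ω be a radial continuous weight on the unit disc. (i) If ω is regular, then there exist constants α = α(ω) > 0 and β = β(ω) ≥ α such that ((1−r)/(1−t))^α · ∫_t^1 ω(s) ds ≤ ∫_r^1 ω(s) ds ≤ ((1−r)/(1−t))^β · ∫_t^1 ω(s) ds for all 0 ≤ r ≤ t < 1. (ii) If ω is rapidly increasing, then for each β > 0 there exists a constant C = C(β,ω) > 0 such that ∫_r^1 ω(s) ds ≤ C ((1−r)/(1−t))^β ∫_t^1 ω(s) ds for all 0 ≤ r ≤ t < 1. -/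
open MeasureTheory Set Filter

noncomputable section

/-- `wInt ω r = ∫_r^1 ω(s) ds`. -/
def wInt (ω : ℝ → ℝ) (r : ℝ) : ℝ := ∫ s in r..1, ω s

/-- A radial weight on the unit disc, identified with a function on `[0,1)`:
positive and integrable. -/
def IsRadialWeight (ω : ℝ → ℝ) : Prop :=
  (∀ r ∈ Set.Ico (0:ℝ) 1, 0 < ω r) ∧ IntegrableOn ω (Set.Ico (0:ℝ) 1)

/-- A radial continuous weight. -/
def IsRadialContinuousWeight (ω : ℝ → ℝ) : Prop :=
  IsRadialWeight ω ∧ ContinuousOn ω (Set.Ico (0:ℝ) 1)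

/-- A regular weight: radial continuous with `ψ_ω(r) ≍ 1 - r`, i.e.
`(1-r)·ω(r) ≍ ∫_r^1 ω(s) ds` on `[0,1)`. -/
def IsRegularWeight (ω : ℝ → ℝ) : Prop :=
  IsRadialContinuousWeight ω ∧ ∃ c C : ℝ, 0 < c ∧ 0 < C ∧
    ∀ r ∈ Set.Ico (0:ℝ) 1,
      c * ((1 - r) * ω r) ≤ wInt ω r ∧ wInt ω r ≤ C * ((1 - r) * ω r)

/-- A rapidly increasing weight: radial continuous with
`ψ_ω(r)/(1-r) = (∫_r^1 ω)/(ω(r)(1-r)) → ∞` as `r → 1⁻`. -/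
def IsRapidlyIncreasing (ω : ℝ → ℝ) : Prop :=
  IsRadialContinuousWeight ω ∧
    Tendsto (fun r => wInt ω r / (ω r * (1 - r))) (nhdsWithin 1 (Set.Iio 1)) atTop

namespace IsRadialContinuousWeight

variable {ω : ℝ → ℝ}

lemma intervalIntegrable (h : IsRadialContinuousWeight ω) {r t : ℝ} (hr : 0 ≤ r) (hrt : r ≤ t)
    (ht : t ≤ 1) : IntervalIntegrable ω volume r t := by
  rw [intervalIntegrable_iff_integrableOn_Ico_of_le hrt]
  exact h.1.2.mono_set (Ico_subset_Ico hr ht)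

lemma wInt_pos (h : IsRadialContinuousWeight ω) {r : ℝ} (hr : r ∈ Ico (0 : ℝ) 1) :
    0 < wInt ω r :=
  intervalIntegral.intervalIntegral_pos_of_pos_on (h.intervalIntegrable hr.1 hr.2.le le_rfl)
    (fun x hx => h.1.1 x ⟨hr.1.trans hx.1.le, hx.2⟩) hr.2

lemma wInt_antitoneOn (h : IsRadialContinuousWeight ω) : AntitoneOn (wInt ω) (Ico 0 1) := by
  intro r hr t ht hrt
  have hsplit := intervalIntegral.integral_add_adjacent_intervals
    (h.intervalIntegrable hr.1 hrt ht.2.le) (h.intervalIntegrable ht.1 ht.2.le le_rfl)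
  have hnonneg : 0 ≤ ∫ s in r..t, ω s := by
    refine intervalIntegral.integral_nonneg hrt fun x hx => (h.1.1 x ?_).le
    exact ⟨hr.1.trans hx.1, hx.2.trans_lt ht.2⟩
  unfold wInt
  linarith

lemma continuousOn_wInt (h : IsRadialContinuousWeight ω) : ContinuousOn (wInt ω) (Ico 0 1) := by
  have hint : IntegrableOn ω (uIcc 0 1) := by
    rw [uIcc_of_le zero_le_one, integrableOn_Icc_iff_integrableOn_Ico]
    exact h.1.2
  have hcont := intervalIntegral.continuousOn_primitive_interval_left hint
  rw [uIcc_of_le zero_le_one] at hcont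
  exact hcont.mono Ico_subset_Icc_self

lemma hasDerivAt_wInt (h : IsRadialContinuousWeight ω) {r : ℝ} (hr : r ∈ Ioo (0 : ℝ) 1) :
    HasDerivAt (wInt ω) (-ω r) r := by
  have hcont : ContinuousOn ω (Ioo 0 1) := h.2.mono Ioo_subset_Ico_self
  exact intervalIntegral.integral_hasDerivAt_left (h.intervalIntegrable hr.1.le hr.2.le le_rfl)
    (hcont.stronglyMeasurableAtFilter isOpen_Ioo r hr)
    (hcont.continuousAt (isOpen_Ioo.mem_nhds hr))

lemma hasDerivAt_log_wInt (h : IsRadialContinuousWeight ω) (p : ℝ) {r : ℝ}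
    (hr : r ∈ Ioo (0 : ℝ) 1) :
    HasDerivAt (fun x => Real.log (wInt ω x) - p * Real.log (1 - x))
      (p / (1 - r) - ω r / wInt ω r) r := by
  have hlog := (h.hasDerivAt_wInt hr).log (h.wInt_pos (Ioo_subset_Ico_self hr)).ne'
  have hsub : HasDerivAt (fun x : ℝ => 1 - x) (-1) r := by
    simpa using (hasDerivAt_id r).const_sub 1
  refine (hlog.sub ((hsub.log (sub_pos.2 hr.2).ne').const_mul p)).congr_deriv ?_
  ring

lemma continuousOn_log_wInt (h : IsRadialContinuousWeight ω) (p : ℝ) :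
    ContinuousOn (fun x => Real.log (wInt ω x) - p * Real.log (1 - x)) (Ico 0 1) :=
  (h.continuousOn_wInt.log fun _ hx => (h.wInt_pos hx).ne').sub
    (continuousOn_const.mul ((continuousOn_const.sub continuousOn_id).log
      fun _ hx => (sub_pos.2 hx.2).ne'))

lemma log_rpow_mul_wInt (h : IsRadialContinuousWeight ω) (p : ℝ) {r t : ℝ}
    (hr : r < 1) (ht : t ∈ Ico (0 : ℝ) 1) :
    Real.log (((1 - r) / (1 - t)) ^ p * wInt ω t) =
      p * (Real.log (1 - r) - Real.log (1 - t)) + Real.log (wInt ω t) := by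
  have hr' := sub_pos.2 hr
  have ht' := sub_pos.2 ht.2
  rw [Real.log_mul (Real.rpow_pos_of_pos (div_pos hr' ht') p).ne' (h.wInt_pos ht).ne',
    Real.log_rpow (div_pos hr' ht'), Real.log_div hr'.ne' ht'.ne']

lemma wInt_le_rpow_mul_wInt (h : IsRadialContinuousWeight ω) {a p : ℝ} (ha : 0 ≤ a)
    (hp : ∀ x ∈ Ioo a 1, ω x * (1 - x) ≤ p * wInt ω x) {r t : ℝ}
    (har : a ≤ r) (hrt : r ≤ t) (ht : t < 1) :
    wInt ω r ≤ ((1 - r) / (1 - t)) ^ p * wInt ω t := by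
  have hr0 : r ∈ Ico (0 : ℝ) 1 := ⟨ha.trans har, hrt.trans_lt ht⟩
  have ht0 : t ∈ Ico (0 : ℝ) 1 := ⟨hr0.1.trans hrt, ht⟩
  have hmono : MonotoneOn (fun x => Real.log (wInt ω x) - p * Real.log (1 - x)) (Ico a 1) := by
    refine monotoneOn_of_hasDerivWithinAt_nonneg (f' := fun x => p / (1 - x) - ω x / wInt ω x)
      (convex_Ico a 1) ((h.continuousOn_log_wInt p).mono (Ico_subset_Ico_left ha)) ?_ ?_
    all_goals
      intro x hx
      rw [interior_Ico] at hx
      have hx0 : x ∈ Ioo (0 : ℝ) 1 := ⟨ha.trans_lt hx.1, hx.2⟩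
    · exact (h.hasDerivAt_log_wInt p hx0).hasDerivWithinAt
    · rw [sub_nonneg, div_le_div_iff₀ (h.wInt_pos (Ioo_subset_Ico_self hx0)) (sub_pos.2 hx.2)]
      exact hp x hx
  have hle := hmono ⟨har, hr0.2⟩ ⟨har.trans hrt, ht⟩ hrt
  have hpos := mul_pos (Real.rpow_pos_of_pos (div_pos (sub_pos.2 hr0.2) (sub_pos.2 ht)) p)
    (h.wInt_pos ht0)
  rw [← Real.log_le_log_iff (h.wInt_pos hr0) hpos, h.log_rpow_mul_wInt p hr0.2 ht0]
  linarith

lemma rpow_mul_wInt_le_wInt (h : IsRadialContinuousWeight ω) {p : ℝ}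
    (hp : ∀ x ∈ Ioo (0 : ℝ) 1, p * wInt ω x ≤ ω x * (1 - x)) {r t : ℝ}
    (hr : 0 ≤ r) (hrt : r ≤ t) (ht : t < 1) :
    ((1 - r) / (1 - t)) ^ p * wInt ω t ≤ wInt ω r := by
  have hr0 : r ∈ Ico (0 : ℝ) 1 := ⟨hr, hrt.trans_lt ht⟩
  have ht0 : t ∈ Ico (0 : ℝ) 1 := ⟨hr.trans hrt, ht⟩
  have hanti : AntitoneOn (fun x => Real.log (wInt ω x) - p * Real.log (1 - x)) (Ico 0 1) := by
    refine antitoneOn_of_hasDerivWithinAt_nonpos (f' := fun x => p / (1 - x) - ω x / wInt ω x)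
      (convex_Ico 0 1) (h.continuousOn_log_wInt p) ?_ ?_
    all_goals
      intro x hx
      rw [interior_Ico] at hx
    · exact (h.hasDerivAt_log_wInt p hx).hasDerivWithinAt
    · rw [sub_nonpos, div_le_div_iff₀ (sub_pos.2 hx.2) (h.wInt_pos (Ioo_subset_Ico_self hx))]
      exact hp x hx
  have hle := hanti hr0 ht0 hrt
  have hpos := mul_pos (Real.rpow_pos_of_pos (div_pos (sub_pos.2 hr0.2) (sub_pos.2 ht)) p)
    (h.wInt_pos ht0)
  rw [← Real.log_le_log_iff hpos (h.wInt_pos hr0), h.log_rpow_mul_wInt p hr0.2 ht0]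
  linarith

end IsRadialContinuousWeight

lemma IsRapidlyIncreasing.exists_le_mul_wInt {ω : ℝ → ℝ} (h : IsRapidlyIncreasing ω) {β : ℝ}
    (hβ : 0 < β) :
    ∃ a ∈ Ico (0 : ℝ) 1, ∀ x ∈ Ioo a 1, ω x * (1 - x) ≤ β * wInt ω x := by
  obtain ⟨a, ha, hsub⟩ := (mem_nhdsLT_iff_exists_Ioo_subset' (zero_lt_one' ℝ)).1
    (h.2.eventually_ge_atTop β⁻¹)
  refine ⟨max a 0, ⟨le_max_right _ _, max_lt ha one_pos⟩, fun x hx => ?_⟩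
  have hx0 : x ∈ Ico (0 : ℝ) 1 := ⟨(le_max_right _ _).trans hx.1.le, hx.2⟩
  have hle : β⁻¹ ≤ wInt ω x / (ω x * (1 - x)) := hsub ⟨(le_max_left _ _).trans_lt hx.1, hx.2⟩
  rwa [le_div_iff₀ (mul_pos (h.1.1.1 x hx0) (sub_pos.2 hx.2)), inv_mul_le_iff₀ hβ] at hle

theorem stmt0 (ω : ℝ → ℝ) (hω : IsRadialContinuousWeight ω) :
    (IsRegularWeight ω → ∃ α β : ℝ, 0 < α ∧ α ≤ β ∧
      ∀ r t : ℝ, 0 ≤ r → r ≤ t → t < 1 →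
        ((1 - r) / (1 - t)) ^ α * wInt ω t ≤ wInt ω r ∧
          wInt ω r ≤ ((1 - r) / (1 - t)) ^ β * wInt ω t) ∧
    (IsRapidlyIncreasing ω → ∀ β : ℝ, 0 < β → ∃ C : ℝ, 0 < C ∧
      ∀ r t : ℝ, 0 ≤ r → r ≤ t → t < 1 →
        wInt ω r ≤ C * (((1 - r) / (1 - t)) ^ β * wInt ω t)) := by
  have h0 : (0 : ℝ) ∈ Ico (0 : ℝ) 1 := ⟨le_rfl, one_pos⟩
  constructor
  · rintro ⟨-, c, C, hc, hC, hcC⟩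
    refine ⟨C⁻¹, c⁻¹, inv_pos.2 hC, ?_, fun r t hr hrt ht => ⟨?_, ?_⟩⟩
    · have hle := (hcC 0 h0).1.trans (hcC 0 h0).2
      have hpos : 0 < (1 - 0) * ω 0 := by simpa using hω.1.1 0 h0
      exact inv_anti₀ hc (le_of_mul_le_mul_right hle hpos)
    · refine hω.rpow_mul_wInt_le_wInt (fun x hx => ?_) hr hrt ht
      rw [inv_mul_le_iff₀ hC, mul_comm (ω x)]
      exact (hcC x (Ioo_subset_Ico_self hx)).2
    · refine hω.wInt_le_rpow_mul_wInt le_rfl (fun x hx => ?_) hr hrt ht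
      rw [le_inv_mul_iff₀ hc, mul_comm (ω x)]
      exact (hcC x (Ioo_subset_Ico_self hx)).1
  · intro hrapid β hβ
    obtain ⟨a, ha, hle⟩ := hrapid.exists_le_mul_wInt hβ
    have hWa := hω.wInt_pos ha
    have hC : 1 ≤ wInt ω 0 / wInt ω a := (one_le_div hWa).2 (hω.wInt_antitoneOn h0 ha ha.1)
    refine ⟨wInt ω 0 / wInt ω a, one_pos.trans_le hC, fun r t hr hrt ht => ?_⟩
    have hr0 : r ∈ Ico (0 : ℝ) 1 := ⟨hr, hrt.trans_lt ht⟩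
    have ht0 : t ∈ Ico (0 : ℝ) 1 := ⟨hr.trans hrt, ht⟩
    have hWt := hω.wInt_pos ht0
    have hr1 := sub_pos.2 hr0.2
    have ht1 := sub_pos.2 ht
    rcases le_total a r with har | hra
    · have hrt' := hω.wInt_le_rpow_mul_wInt ha.1 hle har hrt ht
      exact hrt'.trans (le_mul_of_one_le_left ((hω.wInt_pos hr0).le.trans hrt') hC)
    -- For `r ≤ a` it suffices to bound `wInt ω a` by the bracket.
    have hWa_le : wInt ω a ≤ ((1 - r) / (1 - t)) ^ β * wInt ω t := by
      rcases le_total a t with hat | hta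
      · refine (hω.wInt_le_rpow_mul_wInt ha.1 hle le_rfl hat ht).trans ?_
        have ha1 := sub_pos.2 ha.2
        gcongr
      · refine (hω.wInt_antitoneOn ht0 ha hta).trans (le_mul_of_one_le_left hWt.le ?_)
        exact Real.one_le_rpow ((one_le_div ht1).2 (by linarith)) hβ.le
    calc wInt ω r ≤ wInt ω 0 := hω.wInt_antitoneOn h0 hr0 hr
      _ = wInt ω 0 / wInt ω a * wInt ω a := (div_mul_cancel₀ _ hWa.ne').symm
      _ ≤ _ := mul_le_mul_of_nonneg_left hWa_le (one_pos.trans_le hC).le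
end
end

section
/- Let ω be a radial weight on the unit disc. Then ∫_0^1 dr/ψ_ω(r) = ∞, where ψ_ω(r) = (1/ω(r)) ∫_r^1 ω(s) ds. Moreover, for each function λ: [0,1) → (0,∞) such that h(r) = ∫_0^r ds/(λ(s)(1−s)) is finite for all 0 < r < 1 and lim_{r→1⁻} h(r) = ∞, there exists a radial weight ω_λ (for instance ω_λ(r) = C·exp(−h(r))/(λ(r)(1−r)) for any C > 0) such that ψ_{ω_λ}(r)/(1−r) = λ(r) for all 0 < r < 1. -/
open MeasureTheory Set Filter

noncomputable section

open Topology

/-- Composing an absolutely continuous function with a Lipschitz function gives an absolutely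
continuous function. -/
lemma LipschitzOnWith.comp_absolutelyContinuousOnInterval {φ f : ℝ → ℝ} {K : NNReal} {s : Set ℝ}
    {a b : ℝ} (hφ : LipschitzOnWith K φ s) (hf : AbsolutelyContinuousOnInterval f a b)
    (hs : MapsTo f (uIcc a b) s) : AbsolutelyContinuousOnInterval (fun x ↦ φ (f x)) a b := by
  have hlim := Tendsto.const_mul (K : ℝ) hf
  rw [mul_zero] at hlim
  refine squeeze_zero' (Eventually.of_forall fun E ↦ Finset.sum_nonneg fun i _ ↦ dist_nonneg)
    ?_ hlim
  filter_upwards [mem_inf_of_right (mem_principal_self _)] with E hE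
  rw [Finset.mul_sum]
  exact Finset.sum_le_sum fun i hi ↦
    hφ.dist_le_mul _ (hs (hE.1 i hi).1) _ (hs (hE.1 i hi).2)

/-- Composing an absolutely continuous function with a `C¹` function gives an absolutely
continuous function. -/
lemma ContDiff.comp_absolutelyContinuousOnInterval {φ f : ℝ → ℝ} {a b : ℝ}
    (hφ : ContDiff ℝ 1 φ) (hf : AbsolutelyContinuousOnInterval f a b) :
    AbsolutelyContinuousOnInterval (fun x ↦ φ (f x)) a b := by
  obtain ⟨M, hM⟩ := hf.exists_bound
  obtain ⟨K, hK⟩ := hφ.contDiffOn.exists_lipschitzOnWith (by decide) (convex_Icc (-M) M)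
    isCompact_Icc
  exact hK.comp_absolutelyContinuousOnInterval hf fun x hx ↦ abs_le.mp (hM x hx)

/-- The integral of `g exp(-h)`, where `h` is the primitive of `g` vanishing at `a`. -/
lemma integral_mul_exp_neg_primitive {g : ℝ → ℝ} {a b : ℝ}
    (hg : IntervalIntegrable g volume a b) :
    ∫ x in a..b, g x * Real.exp (-∫ s in a..x, g s) = 1 - Real.exp (-∫ s in a..b, g s) := by
  have hac := ContDiff.comp_absolutelyContinuousOnInterval
    (φ := fun y ↦ -Real.exp (-y)) (by fun_prop)
    (hg.absolutelyContinuousOnInterval_intervalIntegral left_mem_uIcc)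
  have hftc := hac.integral_deriv_eq_sub
  simp only [intervalIntegral.integral_same, neg_zero, Real.exp_zero] at hftc
  rw [show 1 - Real.exp (-∫ s in a..b, g s) = -Real.exp (-∫ s in a..b, g s) - -1 by ring, ← hftc]
  refine intervalIntegral.integral_congr_ae ?_
  filter_upwards [hg.ae_hasDerivAt_integral] with x hx hxab
  have hd := (hx (uIoc_subset_uIcc hxab) a left_mem_uIcc).neg.exp.neg
  refine Eq.trans ?_ hd.deriv.symm
  simp only [Pi.neg_apply]
  ring

/-- `g exp(-h)` is integrable where `g` is, if `h` is a primitive of `g`. -/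
lemma intervalIntegrable_mul_exp_neg_primitive {g : ℝ → ℝ} {a b : ℝ}
    (hg : IntervalIntegrable g volume a b) :
    IntervalIntegrable (fun x ↦ g x * Real.exp (-∫ s in a..x, g s)) volume a b :=
  hg.mul_continuousOn
    (hg.absolutelyContinuousOnInterval_intervalIntegral left_mem_uIcc).continuousOn.neg.rexp

/-- `g exp(-h)` is integrable up to the endpoint `b` when `g ≥ 0` is only locally integrable
on `[a, b)`. -/
lemma intervalIntegrable_mul_exp_neg_primitive_of_nonneg {g : ℝ → ℝ} {a b : ℝ} (hab : a < b)
    (hg₀ : ∀ x ∈ Ico a b, 0 ≤ g x) (hg : ∀ r ∈ Ioo a b, IntervalIntegrable g volume a r) :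
    IntervalIntegrable (fun x ↦ g x * Real.exp (-∫ s in a..x, g s)) volume a b := by
  obtain ⟨u, -, hu, hulim⟩ := exists_seq_strictMono_tendsto' hab
  rw [intervalIntegrable_iff_integrableOn_Ioc_of_le hab.le]
  refine integrableOn_Ioc_of_intervalIntegral_norm_bounded_right (I := 1) (l := atTop) (b := u)
    (fun n ↦ (intervalIntegrable_iff_integrableOn_Ioc_of_le (hu n).1.le).mp
      (intervalIntegrable_mul_exp_neg_primitive (hg _ (hu n)))) hulim
    (Eventually.of_forall fun n ↦ ?_)
  have hnorm : ∫ x in Ioc a (u n), ‖g x * Real.exp (-∫ s in a..x, g s)‖ =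
      ∫ x in Ioc a (u n), g x * Real.exp (-∫ s in a..x, g s) := by
    refine setIntegral_congr_fun measurableSet_Ioc fun x hx ↦ ?_
    exact Real.norm_of_nonneg
      (mul_nonneg (hg₀ x ⟨hx.1.le, hx.2.trans_lt (hu n).2⟩) (Real.exp_pos _).le)
  rw [hnorm, ← intervalIntegral.integral_of_le (hu n).1.le,
    integral_mul_exp_neg_primitive (hg _ (hu n))]
  linarith [Real.exp_pos (-∫ s in a..u n, g s)]

/-- If the primitive `h` of `g ≥ 0` tends to infinity at `b`, then the integral of `g exp(-h)`
over `[r, b]` is `exp(-h r)`. -/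
lemma integral_mul_exp_neg_primitive_of_tendsto {g : ℝ → ℝ} {a b : ℝ} (hab : a < b)
    (hg₀ : ∀ x ∈ Ico a b, 0 ≤ g x) (hg : ∀ r ∈ Ioo a b, IntervalIntegrable g volume a r)
    (hlim : Tendsto (fun r ↦ ∫ s in a..r, g s) (𝓝[<] b) atTop) {r : ℝ} (hr : r ∈ Ioo a b) :
    ∫ x in r..b, g x * Real.exp (-∫ s in a..x, g s) = Real.exp (-∫ s in a..r, g s) := by
  have hint := intervalIntegrable_mul_exp_neg_primitive_of_nonneg hab hg₀ hg
  have hcont := intervalIntegral.continuousOn_primitive_interval' hint left_mem_uIcc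
  have hlim₁ : Tendsto (fun R ↦ ∫ x in a..R, g x * Real.exp (-∫ s in a..x, g s)) (𝓝[<] b)
      (𝓝 (∫ x in a..b, g x * Real.exp (-∫ s in a..x, g s))) := by
    refine (hcont b right_mem_uIcc).tendsto.mono_left ?_
    rw [uIcc_of_le hab.le, ← nhdsWithin_Ioo_eq_nhdsLT hab]
    exact nhdsWithin_mono _ Ioo_subset_Icc_self
  have hlim₂ : Tendsto (fun R ↦ ∫ x in a..R, g x * Real.exp (-∫ s in a..x, g s)) (𝓝[<] b)
      (𝓝 1) := by
    have h1 : Tendsto (fun R ↦ 1 - Real.exp (-∫ s in a..R, g s)) (𝓝[<] b) (𝓝 (1 - 0)) :=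
      (Real.tendsto_exp_neg_atTop_nhds_zero.comp hlim).const_sub 1
    rw [sub_zero] at h1
    refine h1.congr' ?_
    filter_upwards [Ioo_mem_nhdsLT hab] with R hR
    exact (integral_mul_exp_neg_primitive (hg R hR)).symm
  have htotal := tendsto_nhds_unique hlim₁ hlim₂
  have hsub := intervalIntegral.integral_interval_sub_left hint
    (intervalIntegrable_mul_exp_neg_primitive (hg r hr))
  rw [← hsub, htotal, integral_mul_exp_neg_primitive (hg r hr)]
  ring

lemma IsRadialWeight.intervalIntegrable {ω : ℝ → ℝ} (hω : IsRadialWeight ω) {r : ℝ}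
    (hr : r ∈ Ico (0 : ℝ) 1) : IntervalIntegrable ω volume r 1 := by
  rw [intervalIntegrable_iff_integrableOn_Ico_of_le hr.2.le]
  exact hω.2.mono_set (Ico_subset_Ico_left hr.1)

lemma IsRadialWeight.wInt_pos {ω : ℝ → ℝ} (hω : IsRadialWeight ω) {r : ℝ}
    (hr : r ∈ Ico (0 : ℝ) 1) : 0 < wInt ω r :=
  intervalIntegral.intervalIntegral_pos_of_pos_on (hω.intervalIntegrable hr)
    (fun x hx ↦ hω.1 x ⟨hr.1.trans hx.1.le, hx.2⟩) hr.2

lemma IsRadialWeight.wInt_anti {ω : ℝ → ℝ} (hω : IsRadialWeight ω) {r s : ℝ}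
    (hr : 0 ≤ r) (hrs : r ≤ s) (hs : s < 1) : wInt ω s ≤ wInt ω r := by
  have hint := hω.intervalIntegrable ⟨hr, hrs.trans_lt hs⟩
  refine intervalIntegral.integral_mono_interval hrs hs.le le_rfl ?_ hint
  rw [EventuallyLE, ae_restrict_iff' measurableSet_Ioc]
  have hne : ∀ᵐ x : ℝ, x ≠ 1 := by simp [ae_iff, measure_singleton]
  filter_upwards [hne] with x hx1 hx
  exact (hω.1 x ⟨hr.trans hx.1.le, hx.2.lt_of_ne hx1⟩).le

/-- The reciprocal of the distortion function has mass at least one on every `[r, 1)`. -/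
lemma IsRadialWeight.one_le_setLIntegral {ω : ℝ → ℝ} (hω : IsRadialWeight ω) {r : ℝ}
    (hr : r ∈ Ico (0 : ℝ) 1) :
    1 ≤ ∫⁻ s in Ico r 1, ENNReal.ofReal (ω s / wInt ω s) := by
  have hW := hω.wInt_pos hr
  have hint : IntegrableOn (fun s ↦ ω s / wInt ω r) (Ico r 1) :=
    (hω.2.mono_set (Ico_subset_Ico_left hr.1)).div_const _
  have hmass : ∫ s in Ico r 1, ω s / wInt ω r = 1 := by
    rw [integral_div, integral_Ico_eq_integral_Ioc, ← intervalIntegral.integral_of_le hr.2.le]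
    exact div_self hW.ne'
  have hpos : ∀ᵐ s ∂volume.restrict (Ico r 1), 0 ≤ ω s / wInt ω r := by
    filter_upwards [ae_restrict_mem measurableSet_Ico] with s hs
    exact div_nonneg (hω.1 s ⟨hr.1.trans hs.1, hs.2⟩).le hW.le
  calc (1 : ENNReal) = ENNReal.ofReal (∫ s in Ico r 1, ω s / wInt ω r) := by simp [hmass]
    _ = ∫⁻ s in Ico r 1, ENNReal.ofReal (ω s / wInt ω r) :=
      ofReal_integral_eq_lintegral_ofReal hint hpos
    _ ≤ ∫⁻ s in Ico r 1, ENNReal.ofReal (ω s / wInt ω s) := by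
      refine setLIntegral_mono' measurableSet_Ico fun s hs ↦ ENNReal.ofReal_le_ofReal ?_
      have hs' : s ∈ Ico (0 : ℝ) 1 := ⟨hr.1.trans hs.1, hs.2⟩
      exact div_le_div_of_nonneg_left (hω.1 s hs').le (hω.wInt_pos hs')
        (hω.wInt_anti hr.1 hs.1 hs.2)

/-- The reciprocal of the distortion function of a radial weight is not integrable. -/
lemma IsRadialWeight.lintegral_eq_top {ω : ℝ → ℝ} (hω : IsRadialWeight ω) :
    ∫⁻ s in Ico (0 : ℝ) 1, ENNReal.ofReal (ω s / wInt ω s) = ⊤ := by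
  by_contra hfin
  have hvol : Tendsto (volume.restrict (Ico (0 : ℝ) 1) ∘ fun r : ℝ ↦ Ico r 1) (𝓝[<] 1) (𝓝 0) := by
    have hlen : Tendsto (fun r : ℝ ↦ ENNReal.ofReal (1 - r)) (𝓝[<] 1) (𝓝 0) := by
      have hc : Continuous fun r : ℝ ↦ ENNReal.ofReal (1 - r) :=
        ENNReal.continuous_ofReal.comp (by fun_prop)
      simpa using (hc.tendsto 1).mono_left nhdsWithin_le_nhds
    refine tendsto_of_tendsto_of_tendsto_of_le_of_le tendsto_const_nhds hlen
      (fun _ ↦ zero_le) fun r ↦ ?_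
    exact (Measure.restrict_apply_le _ _).trans_eq Real.volume_Ico
  have htail := tendsto_setLIntegral_zero hfin hvol
  refine absurd (ge_of_tendsto htail (b := 1) ?_) (by simp)
  filter_upwards [Ioo_mem_nhdsLT zero_lt_one] with r hr
  rw [Measure.restrict_restrict measurableSet_Ico,
    inter_eq_left.mpr (Ico_subset_Ico_left hr.1.le)]
  exact hω.one_le_setLIntegral ⟨hr.1.le, hr.2⟩

/-- The weight `C exp(-h) / (lam (1 - r))` has prescribed distortion function `lam (1 - r)`. -/
lemma isRadialWeight_and_wInt_eq {lam : ℝ → ℝ} (hpos : ∀ r ∈ Ico (0 : ℝ) 1, 0 < lam r)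
    (hint : ∀ r ∈ Ioo (0 : ℝ) 1,
      IntervalIntegrable (fun s ↦ 1 / (lam s * (1 - s))) volume 0 r)
    (hlim : Tendsto (fun r ↦ ∫ s in (0 : ℝ)..r, 1 / (lam s * (1 - s))) (𝓝[<] 1) atTop)
    {C : ℝ} (hC : 0 < C) :
    IsRadialWeight (fun r ↦
      C * Real.exp (-(∫ s in (0 : ℝ)..r, 1 / (lam s * (1 - s)))) / (lam r * (1 - r))) ∧
    ∀ r ∈ Ioo (0 : ℝ) 1,
      wInt (fun u ↦
        C * Real.exp (-(∫ s in (0 : ℝ)..u, 1 / (lam s * (1 - s)))) / (lam u * (1 - u))) r =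
      lam r * (1 - r) *
        (C * Real.exp (-(∫ s in (0 : ℝ)..r, 1 / (lam s * (1 - s)))) / (lam r * (1 - r))) := by
  have hden : ∀ r ∈ Ico (0 : ℝ) 1, 0 < lam r * (1 - r) := fun r hr ↦
    mul_pos (hpos r hr) (sub_pos.mpr hr.2)
  have hg₀ : ∀ r ∈ Ico (0 : ℝ) 1, 0 ≤ 1 / (lam r * (1 - r)) := fun r hr ↦
    (one_div_pos.mpr (hden r hr)).le
  have hform : (fun r ↦
      C * Real.exp (-(∫ s in (0 : ℝ)..r, 1 / (lam s * (1 - s)))) / (lam r * (1 - r))) =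
      fun r ↦ C * (1 / (lam r * (1 - r)) *
        Real.exp (-(∫ s in (0 : ℝ)..r, 1 / (lam s * (1 - s))))) := by
    funext r
    ring
  refine ⟨⟨fun r hr ↦ div_pos (mul_pos hC (Real.exp_pos _)) (hden r hr), ?_⟩, fun r hr ↦ ?_⟩
  · rw [hform, ← intervalIntegrable_iff_integrableOn_Ico_of_le zero_le_one]
    exact (intervalIntegrable_mul_exp_neg_primitive_of_nonneg zero_lt_one hg₀ hint).const_mul C
  · rw [mul_div_cancel₀ _ (hden r ⟨hr.1.le, hr.2⟩).ne', hform, wInt,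
      intervalIntegral.integral_const_mul,
      integral_mul_exp_neg_primitive_of_tendsto zero_lt_one hg₀ hint hlim hr]

theorem stmt3 (ω : ℝ → ℝ) (hω : IsRadialWeight ω) :
    (∫⁻ r in Set.Ico (0:ℝ) 1, ENNReal.ofReal (ω r / wInt ω r) = ⊤) ∧
    (∀ lam : ℝ → ℝ, (∀ r ∈ Set.Ico (0:ℝ) 1, 0 < lam r) →
      (∀ r ∈ Set.Ioo (0:ℝ) 1,
        IntervalIntegrable (fun s => 1 / (lam s * (1 - s))) volume 0 r) →
      Tendsto (fun r => ∫ s in (0:ℝ)..r, 1 / (lam s * (1 - s)))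
        (nhdsWithin 1 (Set.Iio 1)) atTop →
      (∃ ωl : ℝ → ℝ, IsRadialWeight ωl ∧
        ∀ r ∈ Set.Ioo (0:ℝ) 1, wInt ωl r = lam r * (1 - r) * ωl r) ∧
      (∀ C : ℝ, 0 < C →
        IsRadialWeight (fun r =>
          C * Real.exp (-(∫ s in (0:ℝ)..r, 1 / (lam s * (1 - s)))) / (lam r * (1 - r))) ∧
        ∀ r ∈ Set.Ioo (0:ℝ) 1,
          wInt (fun u =>
            C * Real.exp (-(∫ s in (0:ℝ)..u, 1 / (lam s * (1 - s)))) / (lam u * (1 - u))) r =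
          lam r * (1 - r) *
            (C * Real.exp (-(∫ s in (0:ℝ)..r, 1 / (lam s * (1 - s)))) / (lam r * (1 - r))))) := by
  refine ⟨hω.lintegral_eq_top, fun lam hpos hint hlim ↦ ⟨?_, fun C hC ↦
    isRadialWeight_and_wInt_eq hpos hint hlim hC⟩⟩
  exact ⟨_, isRadialWeight_and_wInt_eq hpos hint hlim one_pos⟩
end
end
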